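/- arXiv:1911.09446 — 4 statements merged into one kernel-verified Lean document; each statement's English description precedes it below -/
import Mathlib

section
/- Let p be a prime, E a finite field extension of ℚ_p, m ≥ 1 an integer, and d^×x a Haar measure on the locally compact multiplicative group (E^×)^m such that the volume of (O_E^×)^m lies in Z̄[1/p]. Let n ≥ 1 be an integer and let f : (E^×)^m → ℂ be a function supported on (O_E^×)^m whose values on (O_E^×)^m are algebraic integers and which satisfies f(x·y) = f(x) for all x ∈ (O_E^×)^m and all y ∈ (1 + ϖ_E^n O_E)^m. Then (1 − q_E^{-1})^m · ∫_{(O_E^×)^m} f(x) d^×x lies in Z̄[1/p]. -/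
open MeasureTheory

/-- `Z̄[1/p]`: the set of `z ∈ ℂ` such that `p ^ k * z` is an algebraic integer
for some integer `k ≥ 0`. -/
def zbarLoc (p : ℕ) : Set ℂ :=
  {z : ℂ | ∃ k : ℕ, IsIntegral ℤ ((p : ℂ) ^ k * z)}


/-- The integral of a function over the image of a group `H`, when the function is invariant under
the image of the kernel of a surjection from `H` to a finite group. -/
theorem setIntegral_range_eq_measureReal_ker_mul_sum {G H T : Type*} [Group G] [MeasurableSpace G]
    [MeasurableMul G] (ν : Measure G) [ν.IsMulLeftInvariant] [Group H] [Group T] [Fintype T]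
    (φ : H →* G) (hφ : Function.Injective φ) (π : H →* T) (hπ : Function.Surjective π)
    (hK : MeasurableSet (φ '' {h | π h = 1})) (hfin : ν (Set.range φ) ≠ ⊤) :
    ∃ σ : T → H, ∀ f : G → ℂ, (∀ h k, π k = 1 → f (φ h * φ k) = f (φ h)) →
      ∫ x in Set.range φ, f x ∂ν = (ν.real (φ '' {h | π h = 1}) : ℂ) * ∑ t, f (φ (σ t)) := by
  set K := φ '' {h | π h = 1}
  choose σ hσ using hπ
  have hmem : ∀ t x, x ∈ (fun y ↦ (φ (σ t))⁻¹ * y) ⁻¹' K ↔ ∃ h, π h = t ∧ φ h = x := by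
    intro t x
    constructor
    · rintro ⟨k, hk, hkx⟩
      refine ⟨σ t * k, by rw [map_mul, hσ, hk, mul_one], ?_⟩
      rw [map_mul, hkx, mul_inv_cancel_left]
    · rintro ⟨h, rfl, rfl⟩
      exact ⟨(σ (π h))⁻¹ * h, by simp [hσ], by simp⟩
  have hcover : Set.range φ = ⋃ t, (fun y ↦ (φ (σ t))⁻¹ * y) ⁻¹' K := by
    ext x
    simp only [Set.mem_iUnion, hmem, Set.mem_range]
    exact ⟨fun ⟨h, hh⟩ ↦ ⟨π h, h, rfl, hh⟩, fun ⟨_, h, _, hh⟩ ↦ ⟨h, hh⟩⟩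
  have hmeas : ∀ t, MeasurableSet ((fun y ↦ (φ (σ t))⁻¹ * y) ⁻¹' K) :=
    fun t ↦ measurable_const_mul _ hK
  have hdisj : Pairwise (Function.onFun Disjoint fun t ↦ (fun y ↦ (φ (σ t))⁻¹ * y) ⁻¹' K) := by
    intro t t' htt'
    refine Set.disjoint_left.2 fun x hx hx' ↦ htt' ?_
    obtain ⟨h, rfl, rfl⟩ := (hmem t x).1 hx
    obtain ⟨h', rfl, hh⟩ := (hmem t' _).1 hx'
    rw [hφ hh]
  have hKfin : ν K ≠ ⊤ :=
    ne_top_of_le_ne_top hfin (measure_mono (Set.image_subset_range _ _))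
  refine ⟨σ, fun f hf ↦ ?_⟩
  have hconst : ∀ t, Set.EqOn f (fun _ ↦ f (φ (σ t))) ((fun y ↦ (φ (σ t))⁻¹ * y) ⁻¹' K) := by
    rintro t x ⟨k, hk, hkx⟩
    have hx : x = φ (σ t) * φ k := by rw [hkx, mul_inv_cancel_left]
    rw [hx]
    exact hf _ _ hk
  rw [hcover, integral_iUnion_fintype hmeas hdisj, Finset.mul_sum]
  · refine Finset.sum_congr rfl fun t _ ↦ ?_
    rw [setIntegral_congr_fun (hmeas t) (hconst t), setIntegral_const, measureReal_def,
      measure_preimage_mul, Complex.real_smul, measureReal_def]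
  · intro t
    rw [integrableOn_congr_fun (hconst t) (hmeas t)]
    exact integrableOn_const (by rwa [measure_preimage_mul])

section Uniformizer

variable {R : Type*} [CommRing R] {ϖ : R}

theorem isUnit_iff_notMem_span_of_uniformizer (hϖ : ¬ IsUnit ϖ)
    (hgen : ∀ x : R, x ≠ 0 → ∃ (k : ℕ) (u : Rˣ), x = ϖ ^ k * u) (x : R) :
    IsUnit x ↔ x ∉ Ideal.span {ϖ} := by
  refine ⟨fun hx h ↦ hϖ (isUnit_of_dvd_unit (Ideal.mem_span_singleton.1 h) hx), fun hx ↦ ?_⟩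
  obtain ⟨k, u, rfl⟩ := hgen x (by rintro rfl; exact hx (zero_mem _))
  rcases k with _ | k
  · simp
  · exact absurd (Ideal.mem_span_singleton.2 ⟨ϖ ^ k * u, by ring⟩) hx

theorem isUnit_of_isUnit_mk_pow (hϖ : ¬ IsUnit ϖ)
    (hgen : ∀ x : R, x ≠ 0 → ∃ (k : ℕ) (u : Rˣ), x = ϖ ^ k * u) {n : ℕ} (hn : n ≠ 0) {x : R}
    (hx : IsUnit (Ideal.Quotient.mk (Ideal.span {ϖ ^ n}) x)) : IsUnit x := by
  rw [isUnit_iff_notMem_span_of_uniformizer hϖ hgen]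
  intro hmem
  have hle : Ideal.span {ϖ ^ n} ≤ Ideal.span {ϖ} :=
    Ideal.span_singleton_le_span_singleton.2 (dvd_pow_self ϖ hn)
  have h := hx.map (Ideal.Quotient.factor hle)
  rw [Ideal.Quotient.factor_mk, Ideal.Quotient.eq_zero_iff_mem.2 hmem, isUnit_zero_iff] at h
  have h1 : (1 : R) ∈ Ideal.span {ϖ} := by
    rw [← Ideal.Quotient.eq_zero_iff_mem, map_one, ← h]
  exact hϖ (isUnit_of_dvd_one (Ideal.mem_span_singleton.1 h1))

theorem units_map_mk_pow_surjective (hϖ : ¬ IsUnit ϖ)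
    (hgen : ∀ x : R, x ≠ 0 → ∃ (k : ℕ) (u : Rˣ), x = ϖ ^ k * u) {n : ℕ} (hn : n ≠ 0) :
    Function.Surjective
      (Units.map (Ideal.Quotient.mk (Ideal.span {ϖ ^ n}) : R →* R ⧸ Ideal.span {ϖ ^ n})) := by
  intro a
  obtain ⟨r, hr⟩ := Ideal.Quotient.mk_surjective (a : R ⧸ Ideal.span {ϖ ^ n})
  obtain ⟨u, rfl⟩ := isUnit_of_isUnit_mk_pow hϖ hgen hn (hr ▸ a.isUnit)
  exact ⟨u, Units.ext hr⟩

/-- Cardinalities of the residue field and of the unit group of `R ⧸ (ϖ ^ n)`. -/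
theorem card_quotient_and_card_units_of_uniformizer (hϖ : ¬ IsUnit ϖ)
    (hgen : ∀ x : R, x ≠ 0 → ∃ (k : ℕ) (u : Rˣ), x = ϖ ^ k * u)
    {p : ℕ} [Fact p.Prime] (hpu : ¬ IsUnit (p : R))
    {n : ℕ} (hn : n ≠ 0) [Finite (R ⧸ Ideal.span {ϖ ^ n})] :
    ∃ c e : ℕ, Nat.card (R ⧸ Ideal.span {ϖ}) = p ^ e ∧
      Nat.card (R ⧸ Ideal.span {ϖ ^ n})ˣ = (Nat.card (R ⧸ Ideal.span {ϖ}) - 1) * p ^ c := by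
  have hpmem : (p : R) ∈ Ideal.span {ϖ} := by
    by_contra h
    exact hpu ((isUnit_iff_notMem_span_of_uniformizer hϖ hgen _).2 h)
  have hpn : ((p ^ n : ℕ) : R ⧸ Ideal.span {ϖ ^ n}) = 0 := by
    rw [← map_natCast (Ideal.Quotient.mk _), Ideal.Quotient.eq_zero_iff_mem, Nat.cast_pow,
      Ideal.mem_span_singleton]
    exact pow_dvd_pow_of_dvd (Ideal.mem_span_singleton.1 hpmem) n
  have hpgroup : IsPGroup p (Multiplicative (R ⧸ Ideal.span {ϖ ^ n})) := by
    refine fun g ↦ ⟨n, Multiplicative.toAdd.injective ?_⟩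
    rw [toAdd_pow, toAdd_one, nsmul_eq_mul, hpn, zero_mul]
  obtain ⟨N, hN⟩ := IsPGroup.iff_card.1 hpgroup
  replace hN : Nat.card (R ⧸ Ideal.span {ϖ ^ n}) = p ^ N := hN
  have hle : Ideal.span {ϖ ^ n} ≤ Ideal.span {ϖ} :=
    Ideal.span_singleton_le_span_singleton.2 (dvd_pow_self ϖ hn)
  set ψ := Ideal.Quotient.factor hle
  have hψ : Function.Surjective ψ := Ideal.Quotient.factor_surjective hle
  set J := ψ.toAddMonoidHom.ker
  have hindex : J.index = Nat.card (R ⧸ Ideal.span {ϖ}) := by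
    have hrange : ψ.toAddMonoidHom.range = ⊤ := AddMonoidHom.range_eq_top.2 hψ
    rw [AddSubgroup.index_ker, hrange]
    exact Nat.card_congr AddSubgroup.topEquiv.toEquiv
  have hmul : Nat.card J * Nat.card (R ⧸ Ideal.span {ϖ}) = p ^ N := by
    rw [← hindex, ← hN, AddSubgroup.card_mul_index]
  obtain ⟨c, -, hc⟩ := (Nat.dvd_prime_pow Fact.out).1 (Dvd.intro _ hmul)
  obtain ⟨e, -, he⟩ := (Nat.dvd_prime_pow Fact.out).1 (Dvd.intro_left _ hmul)
  have hunit : ∀ a : R ⧸ Ideal.span {ϖ ^ n}, IsUnit a ↔ a ∉ J := by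
    intro a
    obtain ⟨r, rfl⟩ := Ideal.Quotient.mk_surjective a
    have hJ : Ideal.Quotient.mk _ r ∈ J ↔ r ∈ Ideal.span {ϖ} :=
      Ideal.Quotient.eq_zero_iff_mem (I := Ideal.span {ϖ})
    rw [hJ, ← isUnit_iff_notMem_span_of_uniformizer hϖ hgen]
    exact ⟨isUnit_of_isUnit_mk_pow hϖ hgen hn, fun h ↦ h.map _⟩
  have hcard : Nat.card (R ⧸ Ideal.span {ϖ ^ n})ˣ + Nat.card J =
      Nat.card (R ⧸ Ideal.span {ϖ ^ n}) := by
    have hU : Nat.card (R ⧸ Ideal.span {ϖ ^ n})ˣ =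
        Set.ncard ((J : Set (R ⧸ Ideal.span {ϖ ^ n}))ᶜ) := by
      rw [← Nat.card_coe_set_eq]
      exact Nat.card_congr <| (Equiv.ofInjective _ Units.val_injective).trans <|
        Equiv.setCongr <| by ext a; simpa [IsUnit] using hunit a
    have hJ : Nat.card J = Set.ncard (J : Set (R ⧸ Ideal.span {ϖ ^ n})) :=
      Nat.card_coe_set_eq _
    rw [hU, hJ, add_comm, Set.ncard_add_ncard_compl]
  refine ⟨c, e, he, ?_⟩
  rw [← hc, Nat.sub_mul, one_mul, mul_comm (Nat.card (R ⧸ Ideal.span {ϖ})), hmul, ← hN, ← hcard,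
    Nat.add_sub_cancel]

end Uniformizer

section PadicExtension

variable (p : ℕ) [Fact p.Prime] (E : Type*) [NormedField E] [Algebra ℚ_[p] E] [Algebra ℤ_[p] E]
  [IsScalarTower ℤ_[p] ℚ_[p] E]

theorem finite_quotient_integralClosure_padicInt [FiniteDimensional ℚ_[p] E]
    {I : Ideal (integralClosure ℤ_[p] E)} (hI : I ≠ ⊥) :
    Finite (integralClosure ℤ_[p] E ⧸ I) := by
  have : CharZero E := charZero_of_injective_algebraMap (algebraMap ℚ_[p] E).injective
  have : Module.Finite ℤ_[p] (integralClosure ℤ_[p] E) :=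
    IsIntegralClosure.finite ℤ_[p] ℚ_[p] E _
  have : Ring.HasFiniteQuotients ℤ_[p] :=
    ⟨fun {I} hI ↦ IsLocalRing.isOpen_iff_finite_quotient.1 (IsDedekindDomain.isOpen_of_ne_bot hI)⟩
  exact (Ring.HasFiniteQuotients.of_module_finite ℤ_[p] _).finiteQuotient hI

theorem not_isUnit_natCast_integralClosure_padicInt :
    ¬ IsUnit (p : integralClosure ℤ_[p] E) := by
  intro h
  obtain ⟨v, hv⟩ := h.exists_right_inv
  have hvE : (p : E) * v = 1 := by simpa using congrArg Subtype.val hv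
  have hp0 : (p : ℚ_[p]) ≠ 0 := Nat.cast_ne_zero.2 (Fact.out : p.Prime).ne_zero
  have hv' : (v : E) = algebraMap ℚ_[p] E (p : ℚ_[p])⁻¹ := by
    rw [map_inv₀, map_natCast]
    exact eq_inv_of_mul_eq_one_right hvE
  have hint : IsIntegral ℤ_[p] (algebraMap ℚ_[p] E (p : ℚ_[p])⁻¹) := hv' ▸ v.2
  rw [isIntegral_algebraMap_iff (algebraMap ℚ_[p] E).injective] at hint
  obtain ⟨y, hy⟩ := IsIntegrallyClosed.isIntegral_iff.1 hint
  have hyp : (y * p : ℤ_[p]) = 1 := by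
    apply PadicInt.ext
    rw [PadicInt.coe_mul, PadicInt.coe_natCast, PadicInt.coe_one]
    exact (congrArg (· * (p : ℚ_[p])) hy).trans (inv_mul_cancel₀ hp0)
  exact PadicInt.p_nonunit (p := p) (IsUnit.of_mul_eq_one_right _ hyp)

theorem isOpen_integralClosure_padicInt [FiniteDimensional ℚ_[p] E] [ContinuousSMul ℚ_[p] E] :
    IsOpen (integralClosure ℤ_[p] E : Set E) := by
  obtain ⟨s, b, hb⟩ := FiniteDimensional.exists_is_basis_integral ℤ_[p] ℚ_[p] E
  have hcont : ∀ i, Continuous (b.coord i) := fun i ↦ LinearMap.continuous_of_finiteDimensional _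
  have hnhds : (integralClosure ℤ_[p] E : Set E) ∈ nhds 0 := by
    have hopen : IsOpen {x : E | ∀ i, ‖b.coord i x‖ < 1} := by
      simp only [Set.ofPred_forall]
      exact isOpen_iInter_of_finite fun i ↦ isOpen_lt (hcont i).norm continuous_const
    refine Filter.mem_of_superset (hopen.mem_nhds (by simp)) fun x hx ↦ ?_
    rw [← b.sum_repr x]
    refine sum_mem fun i _ ↦ ?_
    obtain ⟨c, hc⟩ : ∃ c : ℤ_[p], algebraMap ℤ_[p] ℚ_[p] c = b.repr x i :=
      ⟨⟨b.repr x i, (hx i).le⟩, rfl⟩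
    have hsmul : b.repr x i • b i = c • b i := by rw [← hc, algebraMap_smul]
    rw [hsmul]
    exact Subalgebra.smul_mem _ (hb i) _
  exact (integralClosure ℤ_[p] E).toSubring.toAddSubgroup.isOpen_of_mem_nhds hnhds

end PadicExtension

/-- Lemma `l:softintegrality`, multiplicative case: for a finite extension
`E/ℚ_p`, an `m ≥ 1`, a Haar measure `d^×x` on the multiplicative group `(E^×)^m`
with `∫_{(O_E^×)^m} d^×x ∈ Z̄[1/p]`, and an `f : (E^×)^m → ℂ` supported on
`(O_E^×)^m`, taking values there in the algebraic integers, and right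
multiplication invariant by `(1 + ϖ_E^n O_E)^m` for some `n ≥ 1`, we have
`ζ_E(1)^{-m} ∫_{(O_E^×)^m} f(x) d^×x ∈ Z̄[1/p]`, where
`ζ_E(1)^{-1} = 1 - q_E^{-1}`. -/
theorem statement1
    (p : ℕ) [Fact p.Prime]
    (E : Type*) [NormedField E] [MeasurableSpace E] [BorelSpace E]
    [Algebra ℚ_[p] E] [Algebra ℤ_[p] E] [IsScalarTower ℤ_[p] ℚ_[p] E]
    [FiniteDimensional ℚ_[p] E] [ContinuousSMul ℚ_[p] E]
    -- the ring of integers `O_E` (the valuation ring of `E`, i.e. the integral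
    -- closure of `ℤ_p` in `E`) and its unit group `O_E^×`
    (O : Set E) (hO : O = {x : E | x ∈ integralClosure ℤ_[p] E})
    (Ox : Set E) (hOx : Ox = {x : E | x ≠ 0 ∧ x ∈ O ∧ x⁻¹ ∈ O})
    -- a uniformizer `ϖ_E`
    (ϖ : E) (hϖmem : ϖ ∈ integralClosure ℤ_[p] E) (hϖ0 : ϖ ≠ 0)
    (hϖnonunit : ϖ⁻¹ ∉ O)
    (hϖgen : ∀ x ∈ O, x ≠ 0 → ∃ (k : ℕ) (u : E), u ∈ Ox ∧ x = ϖ ^ k * u)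
    -- the residue field cardinality `q_E`
    (q : ℕ)
    (hq : q = Nat.card
      (↥(integralClosure ℤ_[p] E) ⧸
        Ideal.span {(⟨ϖ, hϖmem⟩ : ↥(integralClosure ℤ_[p] E))}))
    (m : ℕ) (hm : 1 ≤ m)
    -- a Haar measure on the multiplicative group `(E^×)^m` giving `(O_E^×)^m`
    -- volume in `Z̄[1/p]`
    (ν : Measure (Fin m → Eˣ)) [ν.IsHaarMeasure]
    (hvolfin : ν {x : Fin m → Eˣ | ∀ i, (x i : E) ∈ Ox} ≠ ⊤)
    (hvol : ((ν {x : Fin m → Eˣ | ∀ i, (x i : E) ∈ Ox}).toReal : ℂ) ∈ zbarLoc p)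
    (n : ℕ) (hn : 1 ≤ n)
    (f : (Fin m → Eˣ) → ℂ)
    (hsupp : ∀ x : Fin m → Eˣ, x ∉ {x : Fin m → Eˣ | ∀ i, (x i : E) ∈ Ox} → f x = 0)
    (halg : ∀ x ∈ {x : Fin m → Eˣ | ∀ i, (x i : E) ∈ Ox}, IsIntegral ℤ (f x))
    (hinv : ∀ x ∈ {x : Fin m → Eˣ | ∀ i, (x i : E) ∈ Ox}, ∀ y : Fin m → Eˣ,
      (∀ i, ∃ a ∈ O, (y i : E) = 1 + ϖ ^ n * a) → f (x * y) = f x) :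
    (1 - (q : ℂ)⁻¹) ^ m *
      (∫ x in {x : Fin m → Eˣ | ∀ i, (x i : E) ∈ Ox}, f x ∂ν) ∈ zbarLoc p := by
  subst hO hOx
  set R := integralClosure ℤ_[p] E
  set ϖ' : R := ⟨ϖ, hϖmem⟩
  have hϖnu : ¬ IsUnit ϖ' := by
    intro h
    obtain ⟨v, hv⟩ := h.exists_right_inv
    have hvE : ϖ * v = 1 := congrArg Subtype.val hv
    exact hϖnonunit (eq_inv_of_mul_eq_one_right hvE ▸ v.2)
  let φ₀ : Rˣ →* Eˣ := Units.map (algebraMap R E : R →* E)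
  have hφ₀ : Function.Injective φ₀ := Units.map_injective Subtype.val_injective
  have hrange₀ : ∀ x : Eˣ, (∃ u, φ₀ u = x) ↔
      (x : E) ∈ {x : E | x ≠ 0 ∧ x ∈ {x : E | x ∈ R} ∧ x⁻¹ ∈ {x : E | x ∈ R}} := by
    intro x
    constructor
    · rintro ⟨u, rfl⟩
      exact ⟨Units.ne_zero _, (u : R).2, by
        rw [← Units.val_inv_eq_inv_val, ← map_inv]; exact ((u⁻¹ : Rˣ) : R).2⟩
    · rintro ⟨h0, h1, h2⟩
      exact ⟨⟨⟨x, h1⟩, ⟨_, h2⟩, Subtype.ext (mul_inv_cancel₀ h0),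
        Subtype.ext (inv_mul_cancel₀ h0)⟩, Units.ext rfl⟩
  have hgen : ∀ x : R, x ≠ 0 → ∃ (k : ℕ) (u : Rˣ), x = ϖ' ^ k * u := by
    intro x hx
    obtain ⟨k, u, hu, hxu⟩ := hϖgen x x.2 (by simpa using hx)
    obtain ⟨v, hv⟩ := (hrange₀ (Units.mk0 u hu.1)).2 hu
    refine ⟨k, v, Subtype.ext ?_⟩
    have hvu : ((v : R) : E) = u := congrArg Units.val hv
    rw [hxu, ← hvu]
    rfl
  have hn0 : n ≠ 0 := Nat.one_le_iff_ne_zero.1 hn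
  have hϖ'0 : ϖ' ≠ 0 := fun h ↦ hϖ0 (congrArg Subtype.val h)
  set I : Ideal R := Ideal.span {ϖ' ^ n}
  have : Finite (R ⧸ I) := finite_quotient_integralClosure_padicInt p E <| by
    rw [Ne, Ideal.span_singleton_eq_bot]
    exact pow_ne_zero n hϖ'0
  obtain ⟨c, e, hqe, hcard⟩ := card_quotient_and_card_units_of_uniformizer hϖnu hgen
    (not_isUnit_natCast_integralClosure_padicInt p E) hn0
  rw [← hq] at hqe hcard
  let π₀ : Rˣ →* (R ⧸ I)ˣ := Units.map (Ideal.Quotient.mk I : R →* R ⧸ I)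
  have hπ₀ : Function.Surjective π₀ := units_map_mk_pow_surjective hϖnu hgen hn0
  have hker : ∀ u : Rˣ, π₀ u = 1 ↔ ∃ a ∈ R, (φ₀ u : E) = 1 + ϖ ^ n * a := by
    intro u
    have h1 : π₀ u = 1 ↔ (u : R) - 1 ∈ I := by
      rw [← Ideal.Quotient.eq_zero_iff_mem, map_sub, map_one, sub_eq_zero, ← Units.val_inj]
      rfl
    rw [h1, Ideal.mem_span_singleton]
    constructor
    · rintro ⟨a, ha⟩
      refine ⟨a, a.2, ?_⟩
      have : ((u : R) : E) - 1 = ϖ ^ n * a := congrArg Subtype.val ha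
      rw [← this, add_sub_cancel]
      rfl
    · rintro ⟨a, ha, hau⟩
      refine ⟨⟨a, ha⟩, Subtype.ext ?_⟩
      change (φ₀ u : E) - 1 = ϖ ^ n * a
      rw [hau, add_sub_cancel_left]
  have hV : φ₀ '' {u | π₀ u = 1} =
      Units.val ⁻¹' ((fun y ↦ (ϖ ^ n)⁻¹ * (y - 1)) ⁻¹' (R : Set E)) := by
    have hϖn : ϖ ^ n ≠ 0 := pow_ne_zero n hϖ0
    ext y
    constructor
    · rintro ⟨u, hu, rfl⟩
      obtain ⟨a, ha, hau⟩ := (hker u).1 hu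
      simpa [hau, hϖn] using ha
    · intro hy
      set a : R := ⟨_, hy⟩ with ha
      have hya : (y : E) = 1 + ϖ ^ n * a := by
        rw [ha, mul_inv_cancel_left₀ hϖn, add_sub_cancel]
      have hunit : IsUnit (1 + ϖ' ^ n * a) := by
        refine isUnit_of_isUnit_mk_pow hϖnu hgen hn0 ?_
        have : Ideal.Quotient.mk I (ϖ' ^ n * a) = 0 :=
          Ideal.Quotient.eq_zero_iff_mem.2 (Ideal.mem_span_singleton.2 (Dvd.intro _ rfl))
        rw [map_add, map_one, this, add_zero]
        exact isUnit_one
      obtain ⟨u, hu⟩ := hunit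
      have huy : φ₀ u = y := Units.ext <| (congrArg Subtype.val hu).trans hya.symm
      exact ⟨u, (hker u).2 ⟨a, a.2, huy ▸ hya⟩, huy⟩
  have hVmeas : MeasurableSet (φ₀ '' {u | π₀ u = 1}) := by
    rw [hV]
    have hval : Measurable (Units.val : Eˣ → E) := comap_measurable _
    refine hval (IsOpen.measurableSet ?_)
    exact (isOpen_integralClosure_padicInt p E).preimage (by fun_prop)
  have hmulmeas : MeasurableMul Eˣ := by
    have hval : Measurable (Units.val : Eˣ → E) := comap_measurable _
    constructor <;> intro y <;> rw [measurable_comap_iff]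
    · exact (continuous_const_mul (y : E)).measurable.comp hval
    · exact (continuous_mul_const (y : E)).measurable.comp hval
  let φ : (Fin m → Rˣ) →* (Fin m → Eˣ) := MonoidHom.pi fun i ↦ φ₀.comp (Pi.evalMonoidHom _ i)
  let π : (Fin m → Rˣ) →* (Fin m → (R ⧸ I)ˣ) :=
    MonoidHom.pi fun i ↦ π₀.comp (Pi.evalMonoidHom _ i)
  have hφ : Function.Injective φ := hφ₀.comp_left
  have hπ : Function.Surjective π := hπ₀.comp_left
  have hU : {x : Fin m → Eˣ | ∀ i, (x i : E) ∈
      {x : E | x ≠ 0 ∧ x ∈ {x : E | x ∈ R} ∧ x⁻¹ ∈ {x : E | x ∈ R}}} = Set.range φ := by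
    ext x
    simp only [Set.mem_ofPred_eq, Set.mem_range]
    constructor
    · intro h
      choose u hu using fun i ↦ (hrange₀ (x i)).2 (h i)
      exact ⟨u, funext hu⟩
    · rintro ⟨u, rfl⟩ i
      exact (hrange₀ _).1 ⟨u i, rfl⟩
  have hK : MeasurableSet (φ '' {u | π u = 1}) := by
    have : φ '' {u | π u = 1} = Set.univ.pi fun _ ↦ φ₀ '' {u | π₀ u = 1} := by
      ext x
      simp only [Set.mem_pi, Set.mem_univ, true_imp_iff]
      constructor
      · rintro ⟨u, hu, rfl⟩ i
        exact ⟨u i, congrFun hu i, rfl⟩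
      · intro h
        choose u hu hux using h
        exact ⟨u, funext hu, funext hux⟩
    rw [this]
    exact MeasurableSet.univ_pi fun _ ↦ hVmeas
  rw [hU] at hvolfin hvol hinv halg ⊢
  have : Fintype (R ⧸ I)ˣ := Fintype.ofFinite _
  obtain ⟨σ, hσ⟩ := setIntegral_range_eq_measureReal_ker_mul_sum ν φ hφ π hπ hK hvolfin
  have hvolK : ((ν (Set.range φ)).toReal : ℂ) =
      (ν.real (φ '' {u | π u = 1}) : ℂ) * ((q : ℂ) - 1) ^ m * (p : ℂ) ^ (c * m) := by
    have hq1 : 1 ≤ q := hqe ▸ Nat.one_le_pow _ _ (Fact.out : p.Prime).pos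
    have h := hσ (fun _ ↦ 1) fun _ _ _ ↦ rfl
    rw [setIntegral_const, Complex.real_smul, mul_one, measureReal_def] at h
    rw [h, Finset.sum_const, Finset.card_univ, Fintype.card_pi_const, ← Nat.card_eq_fintype_card,
      hcard]
    rw [nsmul_eq_mul, mul_one, mul_pow, ← pow_mul, mul_assoc]
    push_cast [Nat.cast_sub hq1]
    rfl
  rw [hσ f fun h k hk ↦ hinv _ ⟨h, rfl⟩ _ fun i ↦ (hker _).1 (congrFun hk i)]
  obtain ⟨k, hk⟩ := hvol
  have hsum : IsIntegral ℤ (∑ t, f (φ (σ t))) := IsIntegral.sum _ fun t _ ↦ halg _ ⟨_, rfl⟩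
  refine ⟨k + c * m + e * m, ?_⟩
  have hp0 : (p : ℂ) ≠ 0 := Nat.cast_ne_zero.2 (Fact.out : p.Prime).ne_zero
  have hqe' : (p : ℂ) ^ (e * m) * (1 - (q : ℂ)⁻¹) ^ m = ((q : ℂ) - 1) ^ m := by
    have hq0 : (q : ℂ) ≠ 0 := by rw [hqe]; exact_mod_cast pow_ne_zero e hp0
    rw [pow_mul, ← Nat.cast_pow, ← hqe, ← mul_pow, mul_sub, mul_one, mul_inv_cancel₀ hq0]
  have hprod := hk.mul hsum
  rw [hvolK, ← hqe'] at hprod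
  refine (congrArg (IsIntegral ℤ) ?_).mp hprod
  ring
end

section
/- Let p be a prime and F a finite field extension of ℚ_p with uniformizer ϖ_F. Every g ∈ GL₂(F) can be written as g = z·u·diag(ϖ_F^a, 1)·k with z ∈ Z(F), u ∈ U(F), a ∈ ℤ, and k ∈ GL₂(O_F); moreover the integer a is uniquely determined by g. -/
/-- Every nonzero element of an algebraic extension of the fraction field of `R` is an integer power
of `ϖ` times a unit of the integral closure, if this holds for integral elements. -/
theorem exists_zpow_mul_unit_of_integral {R K F : Type*} [CommRing R] [IsDomain R] [Field K]
    [Field F] [Algebra R K] [IsFractionRing R K] [Algebra K F] [Algebra R F] [IsScalarTower R K F]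
    [Algebra.IsAlgebraic K F] {ϖ : F} (hϖ0 : ϖ ≠ 0)
    (hϖgen : ∀ x ∈ integralClosure R F, x ≠ 0 → ∃ (k : ℕ) (u : F), u ≠ 0 ∧
      u ∈ integralClosure R F ∧ u⁻¹ ∈ integralClosure R F ∧ x = ϖ ^ k * u)
    {y : F} (hy : y ≠ 0) :
    ∃ (n : ℤ) (u : F), u ≠ 0 ∧ u ∈ integralClosure R F ∧ u⁻¹ ∈ integralClosure R F ∧
      y = ϖ ^ n * u := by
  have hinj : Function.Injective (algebraMap R F) := by
    rw [IsScalarTower.algebraMap_eq R K F]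
    exact (algebraMap K F).injective.comp (IsFractionRing.injective R K)
  have halg : IsAlgebraic R y :=
    (IsFractionRing.isAlgebraic_iff R K F).2 (Algebra.IsAlgebraic.isAlgebraic y)
  obtain ⟨m, hm0, hm⟩ := halg.exists_integral_multiple
  have hm0' : algebraMap R F m ≠ 0 := (map_ne_zero_iff _ hinj).2 hm0
  rw [Algebra.smul_def] at hm
  obtain ⟨i, u, hu0, hu, hui, hiu⟩ := hϖgen _ hm (mul_ne_zero hm0' hy)
  obtain ⟨j, v, hv0, hv, hvi, hjv⟩ := hϖgen _ (algebraMap_mem _ m) hm0'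
  refine ⟨(i : ℤ) - j, u * v⁻¹, mul_ne_zero hu0 (inv_ne_zero hv0), mul_mem hu hvi, ?_, ?_⟩
  · rw [mul_inv, inv_inv]
    exact mul_mem hui hv
  · rw [hjv] at hiu
    rw [zpow_sub₀ hϖ0, zpow_natCast, zpow_natCast]
    field_simp
    linear_combination hiu

/-- If `ϖ` lies in a subring that does not contain `ϖ⁻¹`, then an integer power of `ϖ` in the
subring has nonnegative exponent. -/
theorem nonneg_of_zpow_mem {F : Type*} [Field F] (S : Subring F) {ϖ : F} (hϖ : ϖ ∈ S)
    (hϖ0 : ϖ ≠ 0) (hϖi : ϖ⁻¹ ∉ S) {n : ℤ} (hn : ϖ ^ n ∈ S) : 0 ≤ n := by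
  by_contra! h
  obtain ⟨m, hm⟩ := Int.eq_ofNat_of_zero_le (show 0 ≤ -n - 1 by lia)
  apply hϖi
  have : ϖ⁻¹ = ϖ ^ n * ϖ ^ m := by
    rw [← zpow_natCast, ← zpow_add₀ hϖ0, ← zpow_neg_one]
    congr 1
    lia
  rw [this]
  exact mul_mem hn (pow_mem hϖ m)

theorem iwasawa_product_eq {F : Type*} [Field F] (z x t : F) (k : Matrix (Fin 2) (Fin 2) F) :
    (z • (1 : Matrix (Fin 2) (Fin 2) F)) * !![1, x; 0, 1] * Matrix.diagonal ![t, 1] * k =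
      !![z * (t * k 0 0 + x * k 1 0), z * (t * k 0 1 + x * k 1 1); z * k 1 0, z * k 1 1] := by
  have hdiag : Matrix.diagonal ![t, 1] = !![t, 0; 0, 1] := by
    ext i j
    fin_cases i <;> fin_cases j <;> simp
  rw [hdiag]
  ext i j
  fin_cases i <;> fin_cases j <;> simp [Matrix.mul_apply, Fin.sum_univ_two] <;> ring

/-- If two matrices over a subring have proportional bottom rows and the first has determinant
invertible in the subring, the proportionality factor lies in the subring. -/
theorem ratio_mem_of_bottom_row {F : Type*} [Field F] (S : Subring F) {z w : F} (hw : w ≠ 0)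
    {k l : Matrix (Fin 2) (Fin 2) F} (hk : ∀ i j, k i j ∈ S) (hl : ∀ i j, l i j ∈ S)
    (hk0 : k.det ≠ 0) (hki : k.det⁻¹ ∈ S) (h0 : z * k 1 0 = w * l 1 0)
    (h1 : z * k 1 1 = w * l 1 1) : z / w ∈ S := by
  have : z / w = (k 0 0 * l 1 1 - k 0 1 * l 1 0) * k.det⁻¹ := by
    field_simp
    rw [Matrix.det_fin_two]
    linear_combination k 0 0 * h1 - k 0 1 * h0
  rw [this]
  exact mul_mem (sub_mem (mul_mem (hk _ _) (hl _ _)) (mul_mem (hk _ _) (hl _ _))) hki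

/-- The exponent of one Iwasawa decomposition is at most that of another. -/
theorem iwasawa_exponent_le {F : Type*} [Field F] (S : Subring F) {ϖ : F} (hϖ : ϖ ∈ S)
    (hϖ0 : ϖ ≠ 0) (hϖi : ϖ⁻¹ ∉ S) {a b : ℤ} {z w x y : F} (hw : w ≠ 0)
    {k l : Matrix (Fin 2) (Fin 2) F} (hk : ∀ i j, k i j ∈ S) (hl : ∀ i j, l i j ∈ S)
    (hk0 : k.det ≠ 0) (hkd : k.det ∈ S) (hl0 : l.det ≠ 0) (hli : l.det⁻¹ ∈ S)
    (hki : k.det⁻¹ ∈ S)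
    (h : (z • (1 : Matrix (Fin 2) (Fin 2) F)) * !![1, x; 0, 1] *
          Matrix.diagonal ![ϖ ^ a, 1] * k =
        (w • (1 : Matrix (Fin 2) (Fin 2) F)) * !![1, y; 0, 1] *
          Matrix.diagonal ![ϖ ^ b, 1] * l) : a ≤ b := by
  have hdet := congrArg Matrix.det h
  simp only [Matrix.det_mul, Matrix.det_smul, Matrix.det_diagonal, Matrix.det_fin_two_of,
    Matrix.det_one, Fintype.card_fin, Fin.prod_univ_two, Matrix.cons_val_zero,
    Matrix.cons_val_one, mul_one, mul_zero, sub_zero] at hdet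
  rw [iwasawa_product_eq, iwasawa_product_eq] at h
  have h0 : z * k 1 0 = w * l 1 0 := by simpa using congrFun (congrFun h 1) 0
  have h1 : z * k 1 1 = w * l 1 1 := by simpa using congrFun (congrFun h 1) 1
  have hzw := ratio_mem_of_bottom_row S hw hk hl hk0 hki h0 h1
  have : ϖ ^ (b - a) = (z / w) ^ 2 * k.det * l.det⁻¹ := by
    rw [zpow_sub₀ hϖ0]
    have := zpow_ne_zero a hϖ0
    field_simp
    linear_combination -hdet
  have := nonneg_of_zpow_mem S hϖ hϖ0 hϖi (n := b - a)
    (this ▸ mul_mem (mul_mem (pow_mem hzw 2) hkd) hli)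
  lia

/-- Existence of the Iwasawa decomposition, given that every nonzero element is an integer power
of `ϖ` times a unit of the subring. -/
theorem exists_iwasawa {F : Type*} [Field F] (S : Subring F) {ϖ : F} (hϖ : ϖ ∈ S)
    (hgen : ∀ y : F, y ≠ 0 → ∃ (n : ℤ) (u : F), u ≠ 0 ∧ u ∈ S ∧ u⁻¹ ∈ S ∧ y = ϖ ^ n * u)
    (g : Matrix (Fin 2) (Fin 2) F) (hg : g.det ≠ 0) :
    ∃ (a : ℤ) (z x : F) (k : Matrix (Fin 2) (Fin 2) F),
      z ≠ 0 ∧ (∀ i j, k i j ∈ S) ∧ k.det ≠ 0 ∧ k.det ∈ S ∧ k.det⁻¹ ∈ S ∧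
      g = (z • (1 : Matrix (Fin 2) (Fin 2) F)) * !![1, x; 0, 1] *
          Matrix.diagonal ![ϖ ^ a, 1] * k := by
  have hdet := Matrix.det_fin_two g
  have hval : ∀ y : F, y ∈ S ∨ (y ≠ 0 ∧ y⁻¹ ∈ S) := by
    intro y
    by_cases hy : y = 0
    · exact Or.inl (hy ▸ zero_mem S)
    obtain ⟨n, u, -, hu, hui, rfl⟩ := hgen y hy
    obtain ⟨m, rfl | rfl⟩ := n.eq_nat_or_neg
    · left
      rw [zpow_natCast]
      exact mul_mem (pow_mem hϖ m) hu
    · right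
      refine ⟨hy, ?_⟩
      rw [mul_inv, zpow_neg, inv_inv, zpow_natCast]
      exact mul_mem (pow_mem hϖ m) hui
  have hcase : (g 1 1 ≠ 0 ∧ g 1 0 / g 1 1 ∈ S) ∨ (g 1 0 ≠ 0 ∧ g 1 1 / g 1 0 ∈ S) := by
    by_cases hd : g 1 1 = 0
    · refine Or.inr ⟨fun hc => hg ?_, by simp [hd, zero_mem]⟩
      rw [hdet, hc, hd]
      ring
    · rcases hval (g 1 0 / g 1 1) with h | ⟨h, h'⟩
      · exact Or.inl ⟨hd, h⟩
      · exact Or.inr ⟨(div_ne_zero_iff.1 h).1, by rwa [inv_div] at h'⟩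
  rcases hcase with ⟨hd, h⟩ | ⟨hc, h⟩
  · obtain ⟨n, v, hv0, hv, hvi, hn⟩ := hgen _ (div_ne_zero hg (pow_ne_zero 2 hd))
    have hkdet : (!![v, 0; g 1 0 / g 1 1, 1] : Matrix (Fin 2) (Fin 2) F).det = v := by
      simp [Matrix.det_fin_two_of]
    refine ⟨n, g 1 1, g 0 1 / g 1 1, !![v, 0; g 1 0 / g 1 1, 1], hd, ?_, by rwa [hkdet],
      by rwa [hkdet], by rwa [hkdet], ?_⟩
    · intro i j
      fin_cases i <;> fin_cases j <;> simp [hv, h, zero_mem, one_mem]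
    · rw [iwasawa_product_eq]
      ext i j
      fin_cases i <;> fin_cases j <;> simp [← hn, hdet] <;> field_simp <;> ring
  · obtain ⟨n, v, hv0, hv, hvi, hn⟩ := hgen _ (div_ne_zero hg (pow_ne_zero 2 hc))
    have hkdet : (!![0, -v; 1, g 1 1 / g 1 0] : Matrix (Fin 2) (Fin 2) F).det = v := by
      simp [Matrix.det_fin_two_of]
    refine ⟨n, g 1 0, g 0 0 / g 1 0, !![0, -v; 1, g 1 1 / g 1 0], hc, ?_, by rwa [hkdet],
      by rwa [hkdet], by rwa [hkdet], ?_⟩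
    · intro i j
      fin_cases i <;> fin_cases j <;> simp [hv, h, zero_mem, one_mem]
    · rw [iwasawa_product_eq]
      ext i j
      fin_cases i <;> fin_cases j <;> simp [← hn, hdet] <;> field_simp <;> ring


/-- Refined Iwasawa decomposition for a finite extension `F/ℚ_p`: every
`g ∈ GL₂(F)` can be written as `g = z·u·diag(ϖ_F^a, 1)·k` with
`z ∈ Z(F)`, `u ∈ U(F)`, `a ∈ ℤ` and `k ∈ GL₂(O_F)`, and the integer `a` is
uniquely determined by `g`. -/
theorem statement4
    (p : ℕ) [Fact p.Prime]
    (F : Type*) [Field F]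
    [Algebra ℚ_[p] F] [Algebra ℤ_[p] F] [IsScalarTower ℤ_[p] ℚ_[p] F]
    [FiniteDimensional ℚ_[p] F]
    -- the ring of integers `O_F` (the valuation ring of `F`, i.e. the integral
    -- closure of `ℤ_p` in `F`)
    (O : Set F) (hO : O = {x : F | x ∈ integralClosure ℤ_[p] F})
    -- a uniformizer `ϖ_F`
    (ϖ : F) (hϖO : ϖ ∈ O) (hϖ0 : ϖ ≠ 0) (hϖnonunit : ϖ⁻¹ ∉ O)
    (hϖgen : ∀ x ∈ O, x ≠ 0 →
      ∃ (k : ℕ) (u : F), u ≠ 0 ∧ u ∈ O ∧ u⁻¹ ∈ O ∧ x = ϖ ^ k * u)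
    (g : Matrix (Fin 2) (Fin 2) F) (hg : IsUnit g.det) :
    ∃! a : ℤ, ∃ (z x : F) (k : Matrix (Fin 2) (Fin 2) F),
      z ≠ 0 ∧
      (∀ i j, k i j ∈ O) ∧ k.det ≠ 0 ∧ k.det ∈ O ∧ (k.det)⁻¹ ∈ O ∧
      g = (z • (1 : Matrix (Fin 2) (Fin 2) F)) * !![1, x; 0, 1] *
          Matrix.diagonal ![ϖ ^ a, 1] * k := by
  subst hO
  have hgen := fun y (hy : y ≠ 0) =>
    exists_zpow_mul_unit_of_integral (R := ℤ_[p]) (K := ℚ_[p]) hϖ0 hϖgen hy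
  let S : Subring F := (integralClosure ℤ_[p] F).toSubring
  obtain ⟨a, ha⟩ := exists_iwasawa S hϖO hgen g hg.ne_zero
  refine ⟨a, ha, ?_⟩
  rintro b ⟨w, y, l, hw, hl, hl0, hld, hli, hgl⟩
  obtain ⟨z, x, k, hz, hk, hk0, hkd, hki, hgk⟩ := ha
  exact le_antisymm
    (iwasawa_exponent_le S hϖO hϖ0 hϖnonunit hz hl hk hl0 hld hk0 hki hli (hgl.symm.trans hgk))
    (iwasawa_exponent_le S hϖO hϖ0 hϖnonunit hw hk hl hk0 hkd hl0 hli hki (hgk.symm.trans hgl))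
end

section
/- Let p be a prime, F a finite field extension of ℚ_p, and n ≥ 0 an integer. Consider the left action on column vectors in (O_F/m_F^n)² of the group Z(O_F)U(O_F) = {(z u; 0 z) : z ∈ O_F^×, u ∈ O_F} (via reduction of entries modulo m_F^n). Then: (i) every primitive vector of (O_F/m_F^n)² lies in the orbit of the reduction of (v, ϖ_F^ℓ) for some integer 0 ≤ ℓ ≤ n and some v ∈ O_F^×; and (ii) for 0 ≤ ℓ, ℓ′ ≤ n and v, v′ ∈ O_F^×, the reductions of (v, ϖ_F^ℓ) and (v′, ϖ_F^{ℓ′}) lie in the same orbit if and only if ℓ = ℓ′ and v′·v^{-1} ∈ 1 + m_F^{min(ℓ, n−ℓ)}. -/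
section OrbitsOfPrimitiveVectors

variable {R : Type*} [CommRing R]

theorem mulVec_map_mk_eq_iff (I : Ideal R) (z u a b : R) (x : Fin 2 → R ⧸ I) :
    ((!![z, u; 0, z]).map (Ideal.Quotient.mk I)).mulVec
        ![Ideal.Quotient.mk I a, Ideal.Quotient.mk I b] = x ↔
      Ideal.Quotient.mk I (z * a + u * b) = x 0 ∧ Ideal.Quotient.mk I (z * b) = x 1 := by
  rw [funext_iff, Fin.forall_fin_two]
  simp [Matrix.mulVec, dotProduct, Fin.sum_univ_two]

theorem exists_normal_form_of_primitive (ϖ : R)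
    (hgen : ∀ x : R, x ≠ 0 → ∃ (k : ℕ) (u : R), IsUnit u ∧ x = ϖ ^ k * u) (n : ℕ)
    (x : Fin 2 → R ⧸ Ideal.span {ϖ ^ n})
    (hx : ∃ u, IsUnit u ∧ (Ideal.Quotient.mk (Ideal.span {ϖ ^ n}) u = x 0 ∨
      Ideal.Quotient.mk (Ideal.span {ϖ ^ n}) u = x 1)) :
    ∃ ℓ : ℕ, ℓ ≤ n ∧ ∃ v : R, IsUnit v ∧ ∃ z u : R, IsUnit z ∧
      Ideal.Quotient.mk (Ideal.span {ϖ ^ n}) (z * v + u * ϖ ^ ℓ) = x 0 ∧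
      Ideal.Quotient.mk (Ideal.span {ϖ ^ n}) (z * ϖ ^ ℓ) = x 1 := by
  obtain ⟨w, hw, h | h⟩ := hx
  · obtain ⟨b, hb⟩ := Ideal.Quotient.mk_surjective (x 1)
    obtain ⟨ℓ, hℓ, z, hz, hzb⟩ : ∃ ℓ ≤ n, ∃ z : R, IsUnit z ∧ ϖ ^ n ∣ z * ϖ ^ ℓ - b := by
      rcases eq_or_ne b 0 with rfl | hb0
      · exact ⟨n, le_rfl, 1, isUnit_one, by simp⟩
      · obtain ⟨k, y, hy, rfl⟩ := hgen b hb0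
        rcases le_total k n with hk | hk
        · exact ⟨k, hk, y, hy, by simp [mul_comm]⟩
        · refine ⟨n, le_rfl, 1, isUnit_one, ?_⟩
          rw [one_mul]
          exact dvd_sub dvd_rfl ((pow_dvd_pow ϖ hk).mul_right y)
    obtain ⟨z, rfl⟩ := hz
    refine ⟨ℓ, hℓ, ↑z⁻¹ * w, z⁻¹.isUnit.mul hw, z, 0, z.isUnit, ?_, ?_⟩
    · simpa using h
    · rw [← hb, Ideal.Quotient.eq, Ideal.mem_span_singleton]
      exact hzb
  · obtain ⟨a, ha⟩ := Ideal.Quotient.mk_surjective (x 0)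
    refine ⟨0, n.zero_le, 1, isUnit_one, w, a - w, hw, ?_, ?_⟩
    · simpa using ha
    · simpa using h

theorem eq_of_pow_dvd_unit_mul_pow_sub_pow [IsDomain R] {ϖ : R} (h0 : ϖ ≠ 0)
    (hnu : ¬ IsUnit ϖ) {n ℓ ℓ' : ℕ} (hℓ : ℓ ≤ n) (hℓ' : ℓ' ≤ n) {z : R} (hz : IsUnit z)
    (h : ϖ ^ n ∣ z * ϖ ^ ℓ - ϖ ^ ℓ') : ℓ = ℓ' := by
  apply le_antisymm
  · rw [← pow_dvd_pow_iff h0 hnu]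
    have h1 := (pow_dvd_pow ϖ hℓ).trans h
    exact (dvd_sub_right (dvd_mul_left _ z)).1 h1
  · rw [← pow_dvd_pow_iff h0 hnu]
    have h1 := (pow_dvd_pow ϖ hℓ').trans h
    exact hz.dvd_mul_left.1 ((dvd_sub_left dvd_rfl).1 h1)

theorem normal_forms_same_orbit_iff [IsDomain R] {ϖ : R} (h0 : ϖ ≠ 0) (hnu : ¬ IsUnit ϖ)
    {n ℓ ℓ' : ℕ} (hℓ : ℓ ≤ n) (hℓ' : ℓ' ≤ n) {v v' : R} (hv : IsUnit v) (hv' : IsUnit v') :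
    (∃ z u : R, IsUnit z ∧ ϖ ^ n ∣ z * v + u * ϖ ^ ℓ - v' ∧ ϖ ^ n ∣ z * ϖ ^ ℓ - ϖ ^ ℓ') ↔
      ℓ = ℓ' ∧ ∃ a ∈ Ideal.span {ϖ ^ min ℓ (n - ℓ)}, v' = v * (1 + a) := by
  constructor
  · rintro ⟨z, u, hz, h1, h2⟩
    obtain rfl := eq_of_pow_dvd_unit_mul_pow_sub_pow h0 hnu hℓ hℓ' hz h2
    refine ⟨rfl, ?_⟩
    have hz1 : ϖ ^ (n - ℓ) ∣ z - 1 := by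
      rw [← mul_dvd_mul_iff_right (pow_ne_zero ℓ h0), ← pow_add, Nat.sub_add_cancel hℓ, sub_mul,
        one_mul]
      exact h2
    have hmin : ϖ ^ min ℓ (n - ℓ) ∣ v' - v := by
      have e : v' - v = (z - 1) * v + u * ϖ ^ ℓ - (z * v + u * ϖ ^ ℓ - v') := by ring
      rw [e]
      refine dvd_sub (dvd_add ?_ ?_) ?_
      · exact ((pow_dvd_pow ϖ (min_le_right _ _)).trans hz1).mul_right v
      · exact (pow_dvd_pow ϖ (min_le_left _ _)).mul_left u
      · exact (pow_dvd_pow ϖ ((min_le_left _ _).trans hℓ)).trans h1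
    obtain ⟨v, rfl⟩ := hv
    refine ⟨↑v⁻¹ * (v' - v), Ideal.mem_span_singleton.2 (hmin.mul_left _), ?_⟩
    simp [mul_sub]
  · rintro ⟨rfl, a, ha, rfl⟩
    obtain ⟨b, rfl⟩ := Ideal.mem_span_singleton.1 ha
    rcases le_total ℓ (n - ℓ) with hle | hle
    · rw [min_eq_left hle]
      refine ⟨1, v * b, isUnit_one, ?_, by simp⟩
      convert dvd_zero (ϖ ^ n) using 1
      ring
    · rw [min_eq_right hle] at hv' ⊢
      refine ⟨1 + ϖ ^ (n - ℓ) * b, 0, isUnit_of_mul_isUnit_right hv', ?_, b, ?_⟩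
      · convert dvd_zero (ϖ ^ n) using 1
        ring
      · conv_rhs => rw [← Nat.sub_add_cancel hℓ, pow_add]
        ring

end OrbitsOfPrimitiveVectors


/-- For a finite extension `F/ℚ_p` and `n ≥ 0`, the orbits of the group
`Z(O_F)U(O_F) = {(z u; 0 z) : z ∈ O_F^×, u ∈ O_F}` acting on primitive column
vectors of `(O_F/m_F^n)²` (by reduction of the entries modulo `m_F^n = (ϖ_F^n)`):
(i) every primitive vector lies in the orbit of the reduction of `(v, ϖ_F^ℓ)`
for some `0 ≤ ℓ ≤ n` and `v ∈ O_F^×`, and (ii) the reductions of `(v, ϖ_F^ℓ)`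
and `(v', ϖ_F^{ℓ'})` lie in the same orbit iff `ℓ = ℓ'` and
`v'·v⁻¹ ∈ 1 + m_F^{min(ℓ, n-ℓ)}`. -/
theorem statement6
    (p : ℕ) [Fact p.Prime]
    (F : Type*) [Field F]
    [Algebra ℚ_[p] F] [Algebra ℤ_[p] F] [IsScalarTower ℤ_[p] ℚ_[p] F]
    [FiniteDimensional ℚ_[p] F]
    -- a uniformizer `ϖ_F` of the ring of integers `O_F = integralClosure ℤ_[p] F`
    (ϖ : ↥(integralClosure ℤ_[p] F)) (hϖ0 : (ϖ : F) ≠ 0)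
    (hϖnonunit : ¬ IsUnit ϖ)
    (hϖgen : ∀ x : ↥(integralClosure ℤ_[p] F), x ≠ 0 →
      ∃ (k : ℕ) (u : ↥(integralClosure ℤ_[p] F)), IsUnit u ∧ x = ϖ ^ k * u)
    (n : ℕ)
    -- reduction modulo `m_F^n = (ϖ_F^n)`
    (red : ↥(integralClosure ℤ_[p] F) →+*
      ↥(integralClosure ℤ_[p] F) ⧸ Ideal.span {ϖ ^ n})
    (hred : red = Ideal.Quotient.mk (Ideal.span {ϖ ^ n})) :
    -- (i) every primitive vector is in the orbit of the reduction of some `(v, ϖ^ℓ)`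
    (∀ x : Fin 2 → (↥(integralClosure ℤ_[p] F) ⧸ Ideal.span {ϖ ^ n}),
      (∃ u, IsUnit u ∧ (red u = x 0 ∨ red u = x 1)) →
      ∃ ℓ : ℕ, ℓ ≤ n ∧ ∃ v : ↥(integralClosure ℤ_[p] F), IsUnit v ∧
        ∃ z u : ↥(integralClosure ℤ_[p] F), IsUnit z ∧
          ((!![z, u; 0, z]).map red).mulVec ![red v, red (ϖ ^ ℓ)] = x) ∧
    -- (ii) description of when two normalized vectors are in the same orbit
    (∀ ℓ ℓ' : ℕ, ℓ ≤ n → ℓ' ≤ n →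
      ∀ v v' : ↥(integralClosure ℤ_[p] F), IsUnit v → IsUnit v' →
      ((∃ z u : ↥(integralClosure ℤ_[p] F), IsUnit z ∧
          ((!![z, u; 0, z]).map red).mulVec ![red v, red (ϖ ^ ℓ)] =
            ![red v', red (ϖ ^ ℓ')]) ↔
        (ℓ = ℓ' ∧ ∃ a ∈ Ideal.span {ϖ ^ (min ℓ (n - ℓ))}, v' = v * (1 + a)))) := by
  subst hred
  have h0 : ϖ ≠ 0 := fun h => hϖ0 (by simp [h])
  simp only [mulVec_map_mk_eq_iff]
  refine ⟨exists_normal_form_of_primitive ϖ hϖgen n, fun ℓ ℓ' hℓ hℓ' v v' hv hv' => ?_⟩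
  rw [← normal_forms_same_orbit_iff h0 hϖnonunit hℓ hℓ' hv hv']
  simp only [Matrix.cons_val_zero, Matrix.cons_val_one, Ideal.Quotient.eq,
    Ideal.mem_span_singleton]
end

section
/- Let p be a prime, F a finite field extension of ℚ_p, and n ≥ 0 an integer. For t ∈ ℤ, ℓ ∈ ℤ, and v ∈ O_F^×, set g_{t,ℓ,v} = (0, ϖ_F^t; −1, −v·ϖ_F^{−ℓ}) ∈ GL₂(F). Then: (i) every g ∈ GL₂(F) lies in the double coset Z(F)U(F)·g_{t,ℓ,v}·K₁(n) for some t ∈ ℤ, some 0 ≤ ℓ ≤ n, and some v ∈ O_F^×; and (ii) for t, t′ ∈ ℤ, 0 ≤ ℓ, ℓ′ ≤ n, and v, v′ ∈ O_F^×, the double cosets Z(F)U(F)·g_{t,ℓ,v}·K₁(n) and Z(F)U(F)·g_{t′,ℓ′,v′}·K₁(n) coincide if and only if t = t′, ℓ = ℓ′, and v′·v^{-1} ∈ 1 + m_F^{min(ℓ, n−ℓ)}. -/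
/-- The double coset `Z(F)U(F)·g_{t,ℓ,v}·K₁(n)` inside `GL₂(F)`, where
`g_{t,ℓ,v} = (0, ϖ^t; -1, -v·ϖ^{-ℓ})`, `Z(F)` is the center, `U(F)` the upper
unipotent subgroup, and `K₁(n) = {(a b; c d) ∈ GL₂(O_F) : c ∈ ϖ^n O_F,
a ∈ 1 + ϖ^n O_F}`; here `O ⊆ F` plays the role of the ring of integers `O_F`
and `ϖ` that of a uniformizer. -/
def doubleCoset (F : Type*) [Field F] (O : Set F) (ϖ : F) (n : ℕ)
    (t ℓ : ℤ) (v : F) : Set (Matrix (Fin 2) (Fin 2) F) :=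
  {g | ∃ (z x : F) (k : Matrix (Fin 2) (Fin 2) F),
    z ≠ 0 ∧
    (∀ i j, k i j ∈ O) ∧ k.det ≠ 0 ∧ k.det ∈ O ∧ (k.det)⁻¹ ∈ O ∧
    (∃ c ∈ O, k 1 0 = ϖ ^ n * c) ∧ (∃ a ∈ O, k 0 0 = 1 + ϖ ^ n * a) ∧
    g = (z • (1 : Matrix (Fin 2) (Fin 2) F)) * !![1, x; 0, 1] *
        !![0, ϖ ^ t; -1, -v * ϖ ^ (-ℓ)] * k}

/-- `ϖ` is a uniformizer of the subring `R` of the field `F`: every nonzero element of `F` is a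
power of `ϖ` times a unit of `R`, and `ϖ` is a nonunit of `R`. -/
structure IsFieldUniformizer {F : Type*} [Field F] (R : Subring F) (ϖ : F) : Prop where
  mem : ϖ ∈ R
  ne_zero : ϖ ≠ 0
  inv_notMem : ϖ⁻¹ ∉ R
  exists_eq_zpow_mul : ∀ x : F, x ≠ 0 →
    ∃ (m : ℤ) (u : F), u ≠ 0 ∧ u ∈ R ∧ u⁻¹ ∈ R ∧ x = ϖ ^ m * u

namespace IsFieldUniformizer

variable {F : Type*} [Field F] {R : Subring F} {ϖ : F}

theorem nonneg_of_zpow_mul_mem (h : IsFieldUniformizer R ϖ) {m : ℤ} {u : F} (hu0 : u ≠ 0)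
    (hu' : u⁻¹ ∈ R) (hm : ϖ ^ m * u ∈ R) : 0 ≤ m := by
  by_contra! hlt
  obtain ⟨k, rfl⟩ : ∃ k : ℕ, m = -(k : ℤ) - 1 := ⟨(-m - 1).toNat, by omega⟩
  apply h.inv_notMem
  have key : ϖ⁻¹ = ϖ ^ k * ((ϖ ^ (-(k : ℤ) - 1) * u) * u⁻¹) := by
    have := h.ne_zero
    rw [zpow_sub₀ this, zpow_neg, zpow_natCast, zpow_one]
    field_simp
  rw [key]
  exact R.mul_mem (R.pow_mem h.mem k) (R.mul_mem hm hu')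

theorem zpow_mem (h : IsFieldUniformizer R ϖ) {m : ℤ} (hm : 0 ≤ m) : ϖ ^ m ∈ R := by
  lift m to ℕ using hm
  rw [zpow_natCast]
  exact R.pow_mem h.mem m

theorem inv_mem_or_exists_eq_mul (h : IsFieldUniformizer R ϖ) {x : F} (hx : x ∈ R) :
    (x ≠ 0 ∧ x⁻¹ ∈ R) ∨ ∃ y ∈ R, x = ϖ * y := by
  by_cases hx0 : x = 0
  · exact Or.inr ⟨0, R.zero_mem, by simp [hx0]⟩
  obtain ⟨m, u, hu0, hu, hu', rfl⟩ := h.exists_eq_zpow_mul x hx0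
  obtain hm | hm := (h.nonneg_of_zpow_mul_mem hu0 hu' hx).eq_or_lt
  · left
    subst hm
    simpa [hu0] using hu'
  · refine Or.inr ⟨ϖ ^ (m - 1) * u, R.mul_mem (h.zpow_mem (by omega)) hu, ?_⟩
    rw [zpow_sub_one₀ h.ne_zero]
    have := h.ne_zero
    field_simp

theorem inv_notMem_of_eq_mul (h : IsFieldUniformizer R ϖ) {x y : F} (hx0 : x ≠ 0) (hy : y ∈ R)
    (hxy : x = ϖ * y) : x⁻¹ ∉ R := by
  intro hx
  apply h.inv_notMem
  have hy0 : y ≠ 0 := by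
    rintro rfl
    simp [hxy] at hx0
  have key : ϖ⁻¹ = y * x⁻¹ := by
    have := h.ne_zero
    rw [hxy]
    field_simp
  rw [key]
  exact R.mul_mem hy hx

end IsFieldUniformizer

/-- Modulo the upper unipotent subgroup on the left, an invertible `2 × 2` matrix is determined by
its bottom row and its determinant. -/
theorem mem_doubleCoset_iff {F : Type*} [Field F] (R : Subring F) {ϖ : F} (hϖ : ϖ ∈ R)
    (n : ℕ) (t ℓ : ℤ) (v : F) (g : Matrix (Fin 2) (Fin 2) F) :
    g ∈ doubleCoset F R ϖ n t ℓ v ↔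
      ∃ z a b c d : F, z ≠ 0 ∧ a ∈ R ∧ b ∈ R ∧ c ∈ R ∧ d ∈ R ∧
        (1 + ϖ ^ n * a) * d - b * (ϖ ^ n * c) ≠ 0 ∧
        ((1 + ϖ ^ n * a) * d - b * (ϖ ^ n * c))⁻¹ ∈ R ∧
        g 1 0 = -z * (1 + ϖ ^ n * a + v * ϖ ^ (-ℓ) * (ϖ ^ n * c)) ∧
        g 1 1 = -z * (b + v * ϖ ^ (-ℓ) * d) ∧
        g 0 0 * g 1 1 - g 0 1 * g 1 0 =
          z ^ 2 * ϖ ^ t * ((1 + ϖ ^ n * a) * d - b * (ϖ ^ n * c)) := by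
  have hn := R.pow_mem hϖ n
  constructor
  · rintro ⟨z, x, k, hz, hk, hdet, -, hdet', ⟨c, hc, hc'⟩, ⟨a, ha, ha'⟩, rfl⟩
    rw [Matrix.det_fin_two, hc', ha'] at hdet hdet'
    refine ⟨z, a, k 0 1, c, k 1 1, hz, ha, hk 0 1, hc, hk 1 1, hdet, hdet', ?_, ?_, ?_⟩
    all_goals
      simp [Matrix.mul_apply, Fin.sum_univ_two, hc', ha']
      ring
  · rintro ⟨z, a, b, c, d, hz, ha, hb, hc, hd, hdet, hdet', h10, h11, hg⟩
    have ha1 : 1 + ϖ ^ n * a ∈ R := R.add_mem R.one_mem (R.mul_mem hn ha)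
    have hc1 : ϖ ^ n * c ∈ R := R.mul_mem hn hc
    set A := 1 + ϖ ^ n * a + v * ϖ ^ (-ℓ) * (ϖ ^ n * c) with hA
    set B := b + v * ϖ ^ (-ℓ) * d with hB
    have hAB : A * d - B * (ϖ ^ n * c) = (1 + ϖ ^ n * a) * d - b * (ϖ ^ n * c) := by
      rw [hA, hB]; ring
    obtain ⟨x, hx0, hx1⟩ : ∃ x, g 0 0 = z * (ϖ ^ t * (ϖ ^ n * c) - x * A) ∧
        g 0 1 = z * (ϖ ^ t * d - x * B) := by
      rw [h10, h11, ← hAB] at hg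
      by_cases hA0 : A = 0
      · have hB0 : B ≠ 0 := by
          intro hB0
          rw [← hAB, hA0, hB0] at hdet
          simp at hdet
        refine ⟨(ϖ ^ t * d - g 0 1 / z) / B, ?_, by field_simp; ring⟩
        have : z * B * (g 0 0 - z * ϖ ^ t * (ϖ ^ n * c)) = 0 := by
          rw [hA0] at hg
          linear_combination -hg
        rw [hA0]
        have := (mul_eq_zero.1 this).resolve_left (mul_ne_zero hz hB0)
        linear_combination this
      · refine ⟨(ϖ ^ t * (ϖ ^ n * c) - g 0 0 / z) / A, by field_simp; ring, ?_⟩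
        field_simp
        apply mul_left_cancel₀ hz
        linear_combination hg
    refine ⟨z, x, !![1 + ϖ ^ n * a, b; ϖ ^ n * c, d], hz, ?_, ?_, ?_, ?_, ⟨c, hc, rfl⟩,
      ⟨a, ha, rfl⟩, ?_⟩
    · intro i j
      fin_cases i <;> fin_cases j <;> simpa
    · simpa [Matrix.det_fin_two] using hdet
    · simpa [Matrix.det_fin_two] using R.sub_mem (R.mul_mem ha1 hd) (R.mul_mem hb hc1)
    · simpa [Matrix.det_fin_two] using hdet'
    · ext i j
      fin_cases i <;> fin_cases j <;>
        simp [Matrix.mul_apply, Fin.sum_univ_two, hx0, hx1, h10, h11, hA, hB] <;> ring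

namespace IsFieldUniformizer

variable {F : Type*} [Field F] {R : Subring F} {ϖ : F}

theorem exists_mem_doubleCoset (h : IsFieldUniformizer R ϖ) (n : ℕ)
    (g : Matrix (Fin 2) (Fin 2) F) (hg : IsUnit g.det) :
    ∃ (t : ℤ) (ℓ : ℕ) (v : F), ℓ ≤ n ∧ v ≠ 0 ∧ v ∈ R ∧ v⁻¹ ∈ R ∧
      g ∈ doubleCoset F R ϖ n t (ℓ : ℤ) v := by
  have hϖ0 := h.ne_zero
  have hD : g 0 0 * g 1 1 - g 0 1 * g 1 0 ≠ 0 := by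
    rw [← Matrix.det_fin_two]; exact hg.ne_zero
  have lower (hc : g 1 0 ≠ 0) (hr : g 1 1 / g 1 0 ∈ R) : ∃ (t : ℤ) (ℓ : ℕ) (v : F),
      ℓ ≤ n ∧ v ≠ 0 ∧ v ∈ R ∧ v⁻¹ ∈ R ∧ g ∈ doubleCoset F R ϖ n t (ℓ : ℤ) v := by
    obtain ⟨t, u, hu0, hu, hu', e⟩ := h.exists_eq_zpow_mul _
      (div_ne_zero hD (pow_ne_zero 2 hc))
    refine ⟨t, 0, 1, Nat.zero_le n, one_ne_zero, R.one_mem, by simp [R.one_mem],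
      (mem_doubleCoset_iff R h.mem ..).2 ⟨-g 1 0, 0, g 1 1 / g 1 0 - u, 0, u, neg_ne_zero.2 hc,
        R.zero_mem, R.sub_mem hr hu, R.zero_mem, hu, by simpa, by simpa, by simp, ?_, ?_⟩⟩
    · simp; field_simp
    · rw [div_eq_iff (pow_ne_zero 2 hc)] at e
      linear_combination e
  have upper (hd : g 1 1 ≠ 0) (s : F) (hs : s ∈ R) (hcs : g 1 0 = g 1 1 * (ϖ ^ n * s)) :
      ∃ (t : ℤ) (ℓ : ℕ) (v : F),
      ℓ ≤ n ∧ v ≠ 0 ∧ v ∈ R ∧ v⁻¹ ∈ R ∧ g ∈ doubleCoset F R ϖ n t (ℓ : ℤ) v := by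
    obtain ⟨t, u, hu0, hu, hu', e⟩ := h.exists_eq_zpow_mul _
      (div_ne_zero hD (pow_ne_zero 2 (mul_ne_zero hd (pow_ne_zero n hϖ0))))
    refine ⟨t, n, u⁻¹, le_rfl, inv_ne_zero hu0, hu', by simpa,
      (mem_doubleCoset_iff R h.mem ..).2 ⟨-(g 1 1 * ϖ ^ n), 0, 0, (s - 1) * u, u,
        neg_ne_zero.2 (mul_ne_zero hd (pow_ne_zero n hϖ0)),
        R.zero_mem, R.zero_mem, R.mul_mem (R.sub_mem hs R.one_mem) hu, hu,
        by simpa, by simpa, ?_, ?_, ?_⟩⟩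
    · rw [hcs, zpow_neg, zpow_natCast]
      field_simp
      ring
    · rw [zpow_neg, zpow_natCast]
      field_simp
      ring
    · rw [div_eq_iff (pow_ne_zero 2 (mul_ne_zero hd (pow_ne_zero n hϖ0)))] at e
      linear_combination e
  by_cases hc : g 1 0 = 0
  · refine upper ?_ 0 R.zero_mem (by simp [hc])
    intro hd
    simp [hc, hd] at hD
  by_cases hd : g 1 1 = 0
  · exact lower hc (by simp [hd, R.zero_mem])
  obtain ⟨m, w, hw0, hw, hw', hm⟩ := h.exists_eq_zpow_mul _ (div_ne_zero hd hc)
  by_cases hm0 : 0 ≤ m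
  · exact lower hc (hm ▸ R.mul_mem (h.zpow_mem hm0) hw)
  by_cases hmn : m ≤ -n
  · refine upper hd (ϖ ^ (-m - n) * w⁻¹) (R.mul_mem (h.zpow_mem (by omega)) hw') ?_
    rw [div_eq_iff hc] at hm
    have e : ϖ ^ n * ϖ ^ (-m - n) * ϖ ^ m = 1 := by
      rw [← zpow_natCast, ← zpow_add₀ hϖ0, ← zpow_add₀ hϖ0]
      ring_nf
      exact zpow_zero ϖ
    rw [hm]
    field_simp
    linear_combination -e
  obtain ⟨t, u, hu0, hu, hu', e⟩ := h.exists_eq_zpow_mul _ (div_ne_zero hD (pow_ne_zero 2 hc))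
  obtain ⟨ℓ, rfl⟩ : ∃ ℓ : ℕ, m = -(ℓ : ℤ) := ⟨(-m).toNat, by omega⟩
  refine ⟨t, ℓ, w * u⁻¹, by omega, mul_ne_zero hw0 (inv_ne_zero hu0), R.mul_mem hw hu', ?_,
    (mem_doubleCoset_iff R h.mem ..).2 ⟨-g 1 0, 0, 0, 0, u, neg_ne_zero.2 hc,
      R.zero_mem, R.zero_mem, R.zero_mem, hu, by simpa, by simpa, by simp, ?_, ?_⟩⟩
  · simpa using R.mul_mem hu hw'
  · rw [div_eq_iff hc] at hm
    rw [hm]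
    field_simp
    ring
  · rw [div_eq_iff (pow_ne_zero 2 hc)] at e
    linear_combination e

theorem doubleCoset_subset (h : IsFieldUniformizer R ϖ) {n ℓ : ℕ} (hℓ : ℓ ≤ n) (t : ℤ)
    {v v' b₀ : F} (hv0 : v ≠ 0) (hv : v ∈ R) (hv' : v⁻¹ ∈ R)
    (hw0 : v' ≠ 0) (hw : v' ∈ R) (hw' : v'⁻¹ ∈ R) (hb₀ : b₀ ∈ R)
    (e : v' = v * (1 + ϖ ^ (min ℓ (n - ℓ)) * b₀)) :
    doubleCoset F R ϖ n t (ℓ : ℤ) v' ⊆ doubleCoset F R ϖ n t (ℓ : ℤ) v := by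
  have hϖ0 := h.ne_zero
  intro g hg
  rw [mem_doubleCoset_iff R h.mem] at hg ⊢
  obtain ⟨z, a, b, c, d, hz, ha, hb, hc, hd, hdet, hdet', h10, h11, hg⟩ := hg
  rw [zpow_neg, zpow_natCast] at *
  have hn := R.pow_mem h.mem n
  obtain hmin | hmin := le_total ℓ (n - ℓ)
  · rw [min_eq_left hmin] at e
    have hvb := R.mul_mem hv hb₀
    have e1 : (1 + ϖ ^ n * (a + v * b₀ * c)) * d - (b + v * b₀ * d) * (ϖ ^ n * c) =
      (1 + ϖ ^ n * a) * d - b * (ϖ ^ n * c) := by ring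
    refine ⟨z, a + v * b₀ * c, b + v * b₀ * d, c, d, hz, R.add_mem ha (R.mul_mem hvb hc),
      R.add_mem hb (R.mul_mem hvb hd), hc, hd, ?_⟩
    rw [e1]
    refine ⟨hdet, hdet', ?_, ?_, hg⟩
    · rw [h10, e]; field_simp; ring
    · rw [h11, e]; field_simp; ring
  · rw [min_eq_right hmin] at e
    obtain ⟨q, rfl⟩ := Nat.exists_eq_add_of_le hℓ
    rw [Nat.add_sub_cancel_left] at e
    have hq := R.mul_mem hw hv'
    have hq2 := R.pow_mem hq 2
    have hγ := R.mul_mem hb₀ hv'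
    have e1 : (1 + ϖ ^ (ℓ + q) * a) * (ϖ ^ (ℓ + q) * (b₀ * v⁻¹) * b + (v' * v⁻¹) ^ 2 * d) -
        b * (ϖ ^ (ℓ + q) * (b₀ * v⁻¹ * (1 + ϖ ^ (ℓ + q) * a) + (v' * v⁻¹) ^ 2 * c)) =
      (v' * v⁻¹) ^ 2 * ((1 + ϖ ^ (ℓ + q) * a) * d - b * (ϖ ^ (ℓ + q) * c)) := by ring
    refine ⟨z * (v * v'⁻¹), a, b, b₀ * v⁻¹ * (1 + ϖ ^ (ℓ + q) * a) + (v' * v⁻¹) ^ 2 * c,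
      ϖ ^ (ℓ + q) * (b₀ * v⁻¹) * b + (v' * v⁻¹) ^ 2 * d,
      mul_ne_zero hz (mul_ne_zero hv0 (inv_ne_zero hw0)), ha, hb,
      R.add_mem (R.mul_mem hγ (R.add_mem R.one_mem (R.mul_mem hn ha))) (R.mul_mem hq2 hc),
      R.add_mem (R.mul_mem (R.mul_mem hn hγ) hb) (R.mul_mem hq2 hd), ?_⟩
    rw [e1]
    refine ⟨mul_ne_zero (pow_ne_zero 2 (mul_ne_zero hw0 (inv_ne_zero hv0))) hdet, ?_, ?_, ?_, ?_⟩
    · rw [mul_inv]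
      refine R.mul_mem ?_ hdet'
      rw [← inv_pow, mul_inv, inv_inv]
      exact R.pow_mem (R.mul_mem hw' hv) 2
    · rw [h10]
      have : v * (1 + ϖ ^ (ℓ + q) * a + v * (ϖ ^ ℓ)⁻¹ *
          (ϖ ^ (ℓ + q) * (b₀ * v⁻¹ * (1 + ϖ ^ (ℓ + q) * a) + (v' * v⁻¹) ^ 2 * c))) =
          v' * (1 + ϖ ^ (ℓ + q) * a + v' * (ϖ ^ ℓ)⁻¹ * (ϖ ^ (ℓ + q) * c)) := by
        rw [pow_add]
        field_simp
        rw [e]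
        ring
      rw [show -(z * (v * v'⁻¹)) = -z * v'⁻¹ * v by ring, mul_assoc (-z * v'⁻¹) v, this]
      field_simp
    · rw [h11]
      have : v * (b + v * (ϖ ^ ℓ)⁻¹ *
          (ϖ ^ (ℓ + q) * (b₀ * v⁻¹) * b + (v' * v⁻¹) ^ 2 * d)) =
          v' * (b + v' * (ϖ ^ ℓ)⁻¹ * d) := by
        rw [pow_add]
        field_simp
        rw [e]
        ring
      rw [show -(z * (v * v'⁻¹)) = -z * v'⁻¹ * v by ring, mul_assoc (-z * v'⁻¹) v, this]
      field_simp
    · rw [hg]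
      field_simp

theorem doubleCoset_eq (h : IsFieldUniformizer R ϖ) {n ℓ : ℕ} (hℓ : ℓ ≤ n) (t : ℤ)
    {v v' b : F} (hv0 : v ≠ 0) (hv : v ∈ R) (hv' : v⁻¹ ∈ R)
    (hw0 : v' ≠ 0) (hw : v' ∈ R) (hw' : v'⁻¹ ∈ R) (hb : b ∈ R)
    (e : v' * v⁻¹ = 1 + ϖ ^ (min ℓ (n - ℓ)) * b) :
    doubleCoset F R ϖ n t (ℓ : ℤ) v = doubleCoset F R ϖ n t (ℓ : ℤ) v' := by
  have e' : v' = v * (1 + ϖ ^ (min ℓ (n - ℓ)) * b) := by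
    rw [← e]; field_simp
  refine (h.doubleCoset_subset hℓ t hw0 hw hw' hv0 hv hv' (b₀ := -(b * (v * v'⁻¹)))
    (R.neg_mem (R.mul_mem hb (R.mul_mem hv hw'))) ?_).antisymm
    (h.doubleCoset_subset hℓ t hv0 hv hv' hw0 hw hw' hb e')
  field_simp
  linear_combination -e'

theorem eq_of_doubleCoset_eq (h : IsFieldUniformizer R ϖ) {n ℓ ℓ' : ℕ} (hℓ : ℓ ≤ n)
    (hℓ' : ℓ' ≤ n) {t t' : ℤ} {v v' : F} (hv0 : v ≠ 0) (hv : v ∈ R) (hv' : v⁻¹ ∈ R)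
    (hw0 : v' ≠ 0) (hw : v' ∈ R) (hw' : v'⁻¹ ∈ R)
    (e : doubleCoset F R ϖ n t (ℓ : ℤ) v = doubleCoset F R ϖ n t' (ℓ' : ℤ) v') :
    t = t' ∧ ℓ = ℓ' ∧ ∃ b ∈ R, v' * v⁻¹ = 1 + ϖ ^ (min ℓ (n - ℓ)) * b := by
  have hϖ0 := h.ne_zero
  have hmem : !![0, ϖ ^ t'; -1, -v' * ϖ ^ (-(ℓ' : ℤ))] ∈
      doubleCoset F R ϖ n t (ℓ : ℤ) v := by
    rw [e, mem_doubleCoset_iff R h.mem]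
    exact ⟨1, 0, 0, 0, 1, one_ne_zero, R.zero_mem, R.zero_mem, R.zero_mem, R.one_mem,
      by simp, by simp [R.one_mem], by simp, by simp, by simp⟩
  rw [mem_doubleCoset_iff R h.mem] at hmem
  obtain ⟨z, a, b, c, d, hz, ha, hb, hc, hd, hdet, hdet', h10, h11, hg⟩ := hmem
  simp only [Matrix.of_apply, Matrix.cons_val', Matrix.cons_val_zero, Matrix.cons_val_one,
    Matrix.cons_val_fin_one] at h10 h11 hg
  have hn := R.pow_mem h.mem n
  obtain ⟨r, rfl⟩ := Nat.exists_eq_add_of_le hℓ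
  have hdR : (1 + ϖ ^ (ℓ + r) * a) * d - b * (ϖ ^ (ℓ + r) * c) ∈ R :=
    R.sub_mem (R.mul_mem (R.add_mem R.one_mem (R.mul_mem hn ha)) hd)
      (R.mul_mem hb (R.mul_mem hn hc))
  set D := (1 + ϖ ^ (ℓ + r) * a) * d - b * (ϖ ^ (ℓ + r) * c) with hD
  set A := 1 + ϖ ^ (ℓ + r) * a + v * ϖ ^ r * c with hA
  set B := ϖ ^ ℓ * b + v * d with hB
  have hAR : A ∈ R := R.add_mem (R.add_mem R.one_mem (R.mul_mem hn ha))
    (R.mul_mem (R.mul_mem hv (R.pow_mem h.mem r)) hc)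
  have hBR : B ∈ R := R.add_mem (R.mul_mem (R.pow_mem h.mem ℓ) hb) (R.mul_mem hv hd)
  have hzA : z * A = 1 := by
    rw [zpow_neg, zpow_natCast, pow_add] at h10
    rw [hA, pow_add]
    field_simp at h10
    linear_combination h10
  have hzB : v' * ϖ ^ (-(ℓ' : ℤ)) = z * B * ϖ ^ (-(ℓ : ℤ)) := by
    have : ϖ ^ ℓ * ϖ ^ (-(ℓ : ℤ)) = 1 := by
      rw [zpow_neg, zpow_natCast]; field_simp
    rw [hB]
    linear_combination -h11 - z * b * this
  have hzt : ϖ ^ t' = z ^ 2 * ϖ ^ t * D := by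
    linear_combination hg
  have hABD : A * d - B * (ϖ ^ r * c) = D := by
    rw [hA, hB, hD]; ring
  obtain ⟨j, u, hu0, hu, hu', rfl⟩ := h.exists_eq_zpow_mul z hz
  have hAj : A = ϖ ^ (-j) * u⁻¹ := by
    rw [zpow_neg]
    field_simp
    linear_combination hzA
  have hBj : B = ϖ ^ ((ℓ : ℤ) - ℓ' - j) * (v' * u⁻¹) := by
    rw [zpow_sub₀ hϖ0, zpow_sub₀ hϖ0]
    rw [zpow_neg, zpow_neg] at hzB
    field_simp at hzB ⊢
    linear_combination -hzB
  have hj : 0 ≤ -j := h.nonneg_of_zpow_mul_mem (inv_ne_zero hu0) (by simpa) (hAj ▸ hAR)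
  have hjB : 0 ≤ (ℓ : ℤ) - ℓ' - j := h.nonneg_of_zpow_mul_mem
    (mul_ne_zero hw0 (inv_ne_zero hu0)) (by simpa using R.mul_mem hu hw') (hBj ▸ hBR)
  have hj0 : j = 0 := by
    by_contra hne
    obtain ⟨i, rfl⟩ : ∃ i : ℕ, j = -(i : ℤ) - 1 := ⟨(-j - 1).toNat, by omega⟩
    have hA1 : A = ϖ * (ϖ ^ i * u⁻¹) := by
      rw [hAj, show -(-(i : ℤ) - 1) = ((i + 1 : ℕ) : ℤ) by push_cast; ring, zpow_natCast]
      ring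
    obtain rfl | ⟨s, rfl⟩ : r = 0 ∨ ∃ s, r = s + 1 := by
      cases r
      · exact Or.inl rfl
      · exact Or.inr ⟨_, rfl⟩
    · obtain ⟨k, hk⟩ : ∃ k : ℕ, (ℓ : ℤ) - ℓ' - (-(i : ℤ) - 1) = ((k + 1 : ℕ) : ℤ) :=
        ⟨ℓ - ℓ' + i, by omega⟩
      rw [hk, zpow_natCast] at hBj
      refine h.inv_notMem_of_eq_mul hdet
        (y := ϖ ^ i * u⁻¹ * d - ϖ ^ k * (v' * u⁻¹) * c) ?_ ?_ hdet'
      · exact R.sub_mem (R.mul_mem (R.mul_mem (R.pow_mem h.mem i) hu') hd)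
          (R.mul_mem (R.mul_mem (R.pow_mem h.mem k) (R.mul_mem hw hu')) hc)
      · rw [← hABD, hA1, hBj]
        ring
    · refine h.inv_notMem_of_eq_mul one_ne_zero
        (y := ϖ ^ i * u⁻¹ - (ϖ ^ (ℓ + s) * a + v * ϖ ^ s * c)) ?_ ?_ (by simp [R.one_mem])
      · exact R.sub_mem (R.mul_mem (R.pow_mem h.mem i) hu')
          (R.add_mem (R.mul_mem (R.pow_mem h.mem _) ha)
            (R.mul_mem (R.mul_mem hv (R.pow_mem h.mem s)) hc))
      · rw [mul_sub, ← hA1, hA]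
        ring
  subst hj0
  have hℓℓ' : ℓ = ℓ' := by
    by_contra hne
    obtain ⟨k, hk⟩ : ∃ k : ℕ, ℓ = ℓ' + k + 1 := ⟨ℓ - ℓ' - 1, by omega⟩
    rw [show (ℓ : ℤ) - ℓ' - 0 = ((k + 1 : ℕ) : ℤ) by omega, zpow_natCast] at hBj
    subst hk
    have hd1 : d = ϖ * (v⁻¹ * (ϖ ^ k * (v' * u⁻¹) - ϖ ^ (ℓ' + k) * b)) := by
      field_simp
      rw [hB] at hBj
      field_simp at hBj
      linear_combination hBj
    have hdm : v⁻¹ * (ϖ ^ k * (v' * u⁻¹) - ϖ ^ (ℓ' + k) * b) ∈ R :=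
      R.mul_mem hv' (R.sub_mem (R.mul_mem (R.pow_mem h.mem k) (R.mul_mem hw hu'))
        (R.mul_mem (R.pow_mem h.mem _) hb))
    refine h.inv_notMem_of_eq_mul hdet
      (y := v⁻¹ * (ϖ ^ k * (v' * u⁻¹) - ϖ ^ (ℓ' + k) * b) +
        ϖ ^ (ℓ' + k + r) * (a * d - b * c)) ?_ ?_ hdet'
    · exact R.add_mem hdm (R.mul_mem (R.pow_mem h.mem _)
        (R.sub_mem (R.mul_mem ha hd) (R.mul_mem hb hc)))
    · rw [mul_add, ← hd1, hD]
      ring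
  subst hℓℓ'
  simp only [zpow_zero, one_mul, neg_zero, sub_self] at hzA hzt hAj hBj
  have htt : t = t' := by
    have hU0 : u ^ 2 * D ≠ 0 := mul_ne_zero (pow_ne_zero 2 hu0) hdet
    have hU : u ^ 2 * D ∈ R := R.mul_mem (R.pow_mem hu 2) hdR
    have hU' : (u ^ 2 * D)⁻¹ ∈ R := by
      rw [mul_inv, ← inv_pow]
      exact R.mul_mem (R.pow_mem hu' 2) hdet'
    have h1 : ϖ ^ (t - t') * (u ^ 2 * D) = 1 := by
      rw [zpow_sub₀ hϖ0, hzt]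
      field_simp
    have h2 : ϖ ^ (t' - t) * (u ^ 2 * D)⁻¹ = 1 := by
      rw [zpow_sub₀ hϖ0, hzt]
      field_simp
    have := h.nonneg_of_zpow_mul_mem hU0 hU' (h1 ▸ R.one_mem)
    have := h.nonneg_of_zpow_mul_mem (inv_ne_zero hU0) (by simpa) (h2 ▸ R.one_mem)
    omega
  subst htt
  refine ⟨rfl, rfl, ?_⟩
  have hDA : D = A ^ 2 := by
    rw [hAj]
    have := zpow_ne_zero t hϖ0
    field_simp
    apply mul_left_cancel₀ this
    linear_combination -hzt
  have hvB : v' = u * B := by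
    rw [hBj]
    field_simp
  rw [Nat.add_sub_cancel_left]
  obtain ⟨i, hi⟩ := Nat.exists_eq_add_of_le (min_le_left ℓ r)
  obtain ⟨k, hk⟩ := Nat.exists_eq_add_of_le (min_le_right ℓ r)
  generalize min ℓ r = m at hi hk ⊢
  refine ⟨u * ϖ ^ i * b * v⁻¹ + ϖ ^ k * (ϖ ^ ℓ * a + v * c) -
    u * ϖ ^ i * ϖ ^ r * (a * d - b * c), ?_, ?_⟩
  · have hP := fun s => R.pow_mem h.mem s
    exact R.sub_mem (R.add_mem (R.mul_mem (R.mul_mem (R.mul_mem hu (hP i)) hb) hv')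
      (R.mul_mem (hP k) (R.add_mem (R.mul_mem (hP ℓ) ha) (R.mul_mem hv hc))))
      (R.mul_mem (R.mul_mem (R.mul_mem hu (hP i)) (hP r))
        (R.sub_mem (R.mul_mem ha hd) (R.mul_mem hb hc)))
  · have hℓm : ϖ ^ ℓ = ϖ ^ m * ϖ ^ i := by rw [hi, pow_add]
    have hrm : ϖ ^ r = ϖ ^ m * ϖ ^ k := by rw [hk, pow_add]
    have hd2 : d = A ^ 2 - ϖ ^ ℓ * ϖ ^ r * (a * d - b * c) := by
      rw [← hDA, hD]
      ring
    have hvA : v' = u * ϖ ^ ℓ * b + v * A - u * v * (ϖ ^ ℓ * ϖ ^ r * (a * d - b * c)) := by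
      rw [hvB, hB]
      linear_combination u * v * hd2 + v * A * hzA
    have hA2 : A = 1 + ϖ ^ r * (ϖ ^ ℓ * a + v * c) := by
      rw [hA]
      ring
    rw [← div_eq_mul_inv, div_eq_iff hv0]
    have hvv : v⁻¹ * v = 1 := inv_mul_cancel₀ hv0
    linear_combination hvA + v * hA2 + (u * b - u * v * ϖ ^ r * (a * d - b * c)) * hℓm
      + v * (ϖ ^ ℓ * a + v * c) * hrm - ϖ ^ m * u * ϖ ^ i * b * hvv

end IsFieldUniformizer

theorem isFieldUniformizer_integralClosure {p : ℕ} [Fact p.Prime]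
    {F : Type*} [Field F]
    [Algebra ℚ_[p] F] [Algebra ℤ_[p] F] [IsScalarTower ℤ_[p] ℚ_[p] F]
    [FiniteDimensional ℚ_[p] F] {ϖ : F} (hmem : ϖ ∈ integralClosure ℤ_[p] F) (hϖ0 : ϖ ≠ 0)
    (hinv : ϖ⁻¹ ∉ integralClosure ℤ_[p] F)
    (hgen : ∀ x ∈ integralClosure ℤ_[p] F, x ≠ 0 → ∃ (k : ℕ) (u : F), u ≠ 0 ∧
      u ∈ integralClosure ℤ_[p] F ∧ u⁻¹ ∈ integralClosure ℤ_[p] F ∧ x = ϖ ^ k * u) :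
    IsFieldUniformizer (integralClosure ℤ_[p] F).toSubring ϖ where
  mem := hmem
  ne_zero := hϖ0
  inv_notMem := hinv
  exists_eq_zpow_mul x hx := by
    obtain ⟨y, hy0, hy⟩ := exists_integral_multiples ℤ_[p] ℚ_[p] {x}
    have hyx := hy x (Finset.mem_singleton_self x)
    have hy0' : algebraMap ℤ_[p] F y ≠ 0 := by
      rw [IsScalarTower.algebraMap_apply ℤ_[p] ℚ_[p] F]
      simpa using hy0
    rw [Algebra.smul_def] at hyx
    obtain ⟨k, u, hu0, hu, hu', e⟩ := hgen _ hyx (mul_ne_zero hy0' hx)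
    obtain ⟨l, w, hw0, hw, hw', e'⟩ := hgen _ (algebraMap_mem _ y) hy0'
    refine ⟨k - l, u * w⁻¹, mul_ne_zero hu0 (inv_ne_zero hw0), mul_mem hu hw', ?_, ?_⟩
    · simpa using mul_mem hw hu'
    · rw [e'] at e
      rw [zpow_sub₀ hϖ0, zpow_natCast, zpow_natCast]
      field_simp
      linear_combination e

/-- For a finite extension `F/ℚ_p` and `n ≥ 0`: (i) every `g ∈ GL₂(F)` lies in
`Z(F)U(F)·g_{t,ℓ,v}·K₁(n)` for some `t ∈ ℤ`, `0 ≤ ℓ ≤ n`, `v ∈ O_F^×`; and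
(ii) `Z(F)U(F)·g_{t,ℓ,v}·K₁(n) = Z(F)U(F)·g_{t',ℓ',v'}·K₁(n)` iff `t = t'`,
`ℓ = ℓ'` and `v'·v⁻¹ ∈ 1 + m_F^{min(ℓ, n-ℓ)}`. -/
theorem statement7
    (p : ℕ) [Fact p.Prime]
    (F : Type*) [Field F]
    [Algebra ℚ_[p] F] [Algebra ℤ_[p] F] [IsScalarTower ℤ_[p] ℚ_[p] F]
    [FiniteDimensional ℚ_[p] F]
    -- the ring of integers `O_F` (the valuation ring of `F`, i.e. the integral
    -- closure of `ℤ_p` in `F`)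
    (O : Set F) (hO : O = {x : F | x ∈ integralClosure ℤ_[p] F})
    -- a uniformizer `ϖ_F`
    (ϖ : F) (hϖO : ϖ ∈ O) (hϖ0 : ϖ ≠ 0) (hϖnonunit : ϖ⁻¹ ∉ O)
    (hϖgen : ∀ x ∈ O, x ≠ 0 →
      ∃ (k : ℕ) (u : F), u ≠ 0 ∧ u ∈ O ∧ u⁻¹ ∈ O ∧ x = ϖ ^ k * u)
    (n : ℕ) :
    -- (i) the double cosets cover `GL₂(F)`
    (∀ g : Matrix (Fin 2) (Fin 2) F, IsUnit g.det →
      ∃ (t : ℤ) (ℓ : ℕ) (v : F), ℓ ≤ n ∧ v ≠ 0 ∧ v ∈ O ∧ v⁻¹ ∈ O ∧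
        g ∈ doubleCoset F O ϖ n t (ℓ : ℤ) v) ∧
    -- (ii) when two such double cosets coincide
    (∀ (t t' : ℤ) (ℓ ℓ' : ℕ) (v v' : F), ℓ ≤ n → ℓ' ≤ n →
      v ≠ 0 → v ∈ O → v⁻¹ ∈ O → v' ≠ 0 → v' ∈ O → v'⁻¹ ∈ O →
      (doubleCoset F O ϖ n t (ℓ : ℤ) v = doubleCoset F O ϖ n t' (ℓ' : ℤ) v' ↔
        (t = t' ∧ ℓ = ℓ' ∧ ∃ b ∈ O, v' * v⁻¹ = 1 + ϖ ^ (min ℓ (n - ℓ)) * b))) := by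
  obtain rfl : O = (((integralClosure ℤ_[p] F).toSubring : Subring F) : Set F) := hO
  have h := isFieldUniformizer_integralClosure hϖO hϖ0 hϖnonunit hϖgen
  refine ⟨h.exists_mem_doubleCoset n, ?_⟩
  intro t t' ℓ ℓ' v v' hℓ hℓ' hv0 hv hv' hw0 hw hw'
  constructor
  · exact h.eq_of_doubleCoset_eq hℓ hℓ' hv0 hv hv' hw0 hw hw'
  · rintro ⟨rfl, rfl, b, hb, e⟩
    exact h.doubleCoset_eq hℓ t hv0 hv hv' hw0 hw hw' hb e
end
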